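/- Let I ⊆ ℂ[x₀,x₁] be a nonzero Borel-fixed monomial ideal of finite colength. For each i ≥ 0 let λᵢ be the least integer b such that x₀ⁱx₁ᵇ ∈ I, and let k be the least integer e such that x₀ᵉ ∈ I. Suppose that: the colength of I is 10; every minimal generator of I has degree at most 5 (equivalently i + λᵢ ≤ 5 for all 0 ≤ i ≤ k); and the Ellia–Peskine condition holds: λᵢ − 2 ≤ λ_{i+1} ≤ λᵢ − 1 for all 0 ≤ i ≤ k−1. Then either I is the ideal generated by all monomials of degree 4 in x₀,x₁ (i.e. I = (x₀,x₁)⁴), or I = (x₀³, x₀²x₁², x₀x₁³, x₁⁵). (This classifies the generic initial ideal of a general hyperplane section of a reduced irreducible degree-10 curve in ℙ³.) -/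

import Mathlib

open MvPolynomial

/-- `e` is (the exponent vector of) a minimal generator of the ideal `I ⊆ ℂ[x₀,x₁]`. -/
def IsMinGen (I : Ideal (MvPolynomial (Fin 2) ℂ)) (e : Fin 2 →₀ ℕ) : Prop :=
  monomial e (1 : ℂ) ∈ I ∧
    ∀ t : Fin 2, e t ≠ 0 → monomial (e - Finsupp.single t 1) (1 : ℂ) ∉ I

/-- A bivariate monomial as a product of powers of the variables. -/
lemma monomial_single_add_single (i b : ℕ) :
    monomial (Finsupp.single (0 : Fin 2) i + Finsupp.single 1 b) (1 : ℂ) = X 0 ^ i * X 1 ^ b := by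
  rw [X_pow_eq_monomial, X_pow_eq_monomial, monomial_mul, one_mul]

lemma monomial_eq_X_pow_mul_X_pow (e : Fin 2 →₀ ℕ) :
    monomial e (1 : ℂ) = X 0 ^ e 0 * X 1 ^ e 1 := by
  rw [monomial_eq, Finsupp.prod_fintype _ _ (by simp), Fin.prod_univ_two, C_1, one_mul]

/-- The number of exponent vectors lying below the staircase `lam`, which is supported on
`i < k`. -/
lemma ncard_lt_staircase (lam : ℕ → ℕ) (k : ℕ) (hlam : ∀ i, k ≤ i → lam i = 0) :
    {e : Fin 2 →₀ ℕ | e 1 < lam (e 0)}.ncard = ∑ i ∈ Finset.range k, lam i := by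
  have hcard : ((Finset.range k).sigma fun i => Finset.range (lam i)).card
      = ∑ i ∈ Finset.range k, lam i := by simp
  rw [← hcard, ← Set.ncard_coe_finset]
  refine Set.ncard_congr (fun e _ => ⟨e 0, e 1⟩) ?_ ?_ ?_
  · intro e he
    have he' : e 1 < lam (e 0) := he
    have hk : e 0 < k := by
      by_contra! h
      simp [hlam _ h] at he'
    simp [hk, he']
  · intro e f _ _ h
    simp only [Sigma.mk.injEq, heq_eq_eq] at h
    ext t
    fin_cases t
    exacts [h.1, h.2]
  · rintro ⟨i, b⟩ h
    simp only [Finset.coe_sigma, Set.mem_sigma_iff, Finset.mem_coe, Finset.mem_range] at h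
    exact ⟨Finsupp.single 0 i + Finsupp.single 1 b, by simpa using h.2, by simp⟩

/-- Let `I ⊆ ℂ[x₀,x₁]` be a nonzero Borel-fixed monomial ideal of
finite colength, with `λ i` the least `b` such that `x₀ⁱx₁ᵇ ∈ I` and `k` the least
`e` with `x₀ᵉ ∈ I`.  Suppose the colength of `I` is 10, every minimal generator has
degree at most 5 (i.e. `i + λ i ≤ 5` for `0 ≤ i ≤ k`), and the Ellia–Peskine
condition `λ i − 2 ≤ λ (i+1) ≤ λ i − 1` holds for `0 ≤ i ≤ k−1`.  Then either
`I = (x₀,x₁)⁴` or `I = (x₀³, x₀²x₁², x₀x₁³, x₁⁵)`. -/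
theorem stmt_9 (I : Ideal (MvPolynomial (Fin 2) ℂ))
    (G : Set (Fin 2 →₀ ℕ))
    (hI : I = Ideal.span ((fun e => monomial e (1 : ℂ)) '' G))
    (hBorel : ∀ e : Fin 2 →₀ ℕ, monomial e (1 : ℂ) ∈ I → e 1 ≠ 0 →
      monomial (e - Finsupp.single 1 1 + Finsupp.single 0 1) (1 : ℂ) ∈ I)
    (hne : I ≠ ⊥)
    (hfin : {e : Fin 2 →₀ ℕ | monomial e (1 : ℂ) ∉ I}.Finite)
    (lam : ℕ → ℕ)
    (hlam : ∀ i : ℕ,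
      monomial (Finsupp.single 0 i + Finsupp.single 1 (lam i)) (1 : ℂ) ∈ I ∧
        ∀ b : ℕ, b < lam i →
          monomial (Finsupp.single 0 i + Finsupp.single 1 b) (1 : ℂ) ∉ I)
    (k : ℕ)
    (hk : monomial (Finsupp.single (0 : Fin 2) k) (1 : ℂ) ∈ I ∧
      ∀ e : ℕ, e < k → monomial (Finsupp.single (0 : Fin 2) e) (1 : ℂ) ∉ I)
    (hcolen : {e : Fin 2 →₀ ℕ | monomial e (1 : ℂ) ∉ I}.ncard = 10)
    (hdeg5 : ∀ i : ℕ, i ≤ k → i + lam i ≤ 5)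
    (hEP : ∀ i : ℕ, i + 1 ≤ k → lam i - 2 ≤ lam (i + 1) ∧ lam (i + 1) ≤ lam i - 1) :
    I = (Ideal.span {X 0, X 1}) ^ 4 ∨
      I = Ideal.span {X 0 ^ 3, X 0 ^ 2 * X 1 ^ 2, X 0 * X 1 ^ 3, X 1 ^ 5} := by
  have hmem : ∀ i b : ℕ, (X 0 ^ i * X 1 ^ b : MvPolynomial (Fin 2) ℂ) ∈ I ↔ lam i ≤ b := by
    intro i b
    rw [← monomial_single_add_single]
    refine ⟨fun h => ?_, fun h => ?_⟩
    · by_contra! hb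
      exact (hlam i).2 b hb h
    · have hi := (hlam i).1
      rw [monomial_single_add_single] at hi ⊢
      rw [← Nat.add_sub_cancel' h, pow_add, ← mul_assoc]
      exact I.mul_mem_right _ hi
  have hzero : ∀ i, k ≤ i → lam i = 0 := by
    intro i hi
    have hXk := hk.1
    rw [← X_pow_eq_monomial] at hXk
    have hXi : (X 0 ^ i * X 1 ^ 0 : MvPolynomial (Fin 2) ℂ) ∈ I := by
      rw [← Nat.add_sub_cancel' hi, pow_add, mul_assoc]
      exact I.mul_mem_right _ hXk
    exact Nat.le_zero.1 ((hmem i 0).1 hXi)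
  have hpos : ∀ i, i < k → lam i ≠ 0 := by
    intro i hi h
    have hXi := (hmem i 0).2 h.le
    rw [pow_zero, mul_one, X_pow_eq_monomial] at hXi
    exact hk.2 i hi hXi
  have hsum : ∑ i ∈ Finset.range k, lam i = 10 := by
    rw [← ncard_lt_staircase lam k hzero, ← hcolen]
    congr 1
    ext e
    simp only [Set.mem_ofPred_eq, monomial_eq_X_pow_mul_X_pow e, hmem, not_le]
  have hshape : (lam 0 = 4 ∧ lam 1 = 3 ∧ lam 2 = 2 ∧ lam 3 = 1 ∧ k = 4) ∨
      (lam 0 = 5 ∧ lam 1 = 3 ∧ lam 2 = 2 ∧ k = 3) := by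
    have hk5 : k ≤ 5 := by have := hdeg5 k le_rfl; omega
    have hlast := hzero k le_rfl
    have hprev := hpos (k - 1)
    have h0 := hdeg5 0 (Nat.zero_le k)
    have e0 := hEP 0
    have e1 := hEP 1
    have e2 := hEP 2
    have e3 := hEP 3
    have e4 := hEP 4
    interval_cases k <;> simp only [Finset.sum_range_succ, Finset.sum_range_zero] at hsum <;>
      norm_num at hprev e0 e1 e2 e3 e4 <;> omega
  have hle : ∀ J : Ideal (MvPolynomial (Fin 2) ℂ),
      (∀ a b : ℕ, lam a ≤ b → (X 0 ^ a * X 1 ^ b : MvPolynomial (Fin 2) ℂ) ∈ J) → I ≤ J := by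
    intro J hJ
    have hG : ∀ e ∈ G, monomial e (1 : ℂ) ∈ I := fun e he => by
      rw [hI]
      exact Ideal.subset_span ⟨e, he, rfl⟩
    rw [hI, Ideal.span_le]
    rintro _ ⟨e, he, rfl⟩
    have heI := hG e he
    rw [monomial_eq_X_pow_mul_X_pow, hmem] at heI
    simpa only [SetLike.mem_coe, monomial_eq_X_pow_mul_X_pow] using hJ _ _ heI
  rcases hshape with ⟨h0, h1, h2, h3, rfl⟩ | ⟨h0, h1, h2, rfl⟩
  · left
    apply le_antisymm
    · refine hle _ fun a b hab => ?_
      have hab4 : 4 ≤ a + b := by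
        by_contra! h
        have ha : a < 4 := by omega
        interval_cases a <;> omega
      refine Ideal.pow_le_pow_right hab4 ?_
      rw [pow_add]
      exact Ideal.mul_mem_mul (Ideal.pow_mem_pow (Ideal.subset_span (by simp)) a)
        (Ideal.pow_mem_pow (Ideal.subset_span (by simp)) b)
    · have h4 := hzero 4 le_rfl
      rw [Ideal.span, Submodule.span_pow, Submodule.span_le]
      intro p hp
      obtain ⟨f, rfl⟩ := Set.mem_pow.1 hp
      have hf : ∀ j, ∃ a b : ℕ, a + b = 1 ∧
          (f j : MvPolynomial (Fin 2) ℂ) = X 0 ^ a * X 1 ^ b := by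
        intro j
        rcases (f j).2 with h | h
        · exact ⟨1, 0, rfl, by simpa using h⟩
        · exact ⟨0, 1, rfl, by simpa using h⟩
      choose a b hab hf using hf
      have hprod : (List.ofFn fun j => (f j : MvPolynomial (Fin 2) ℂ)).prod =
          X 0 ^ (∑ j, a j) * X 1 ^ (∑ j, b j) := by
        rw [List.prod_ofFn, Finset.prod_congr rfl fun j _ => hf j, Finset.prod_mul_distrib,
          Finset.prod_pow_eq_pow_sum, Finset.prod_pow_eq_pow_sum]
      have hdeg : ∑ j, a j + ∑ j, b j = 4 := by
        rw [← Finset.sum_add_distrib, Finset.sum_congr rfl fun j _ => hab j]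
        simp
      rw [hprod, SetLike.mem_coe, hmem]
      generalize ∑ j, a j = m at *
      have hm : m ≤ 4 := by omega
      interval_cases m <;> omega
  · right
    have h3 := hzero 3 le_rfl
    apply le_antisymm
    · refine hle _ fun a b hab => ?_
      have hmul : ∀ i j : ℕ, i ≤ a → j ≤ b →
          (X 0 ^ i * X 1 ^ j : MvPolynomial (Fin 2) ℂ) ∈
            ({X 0 ^ 3, X 0 ^ 2 * X 1 ^ 2, X 0 * X 1 ^ 3, X 1 ^ 5} :
              Set (MvPolynomial (Fin 2) ℂ)) →
          (X 0 ^ a * X 1 ^ b : MvPolynomial (Fin 2) ℂ) ∈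
            Ideal.span {X 0 ^ 3, X 0 ^ 2 * X 1 ^ 2, X 0 * X 1 ^ 3, X 1 ^ 5} :=
        fun i j hi hj h => Ideal.mem_of_dvd _ (mul_dvd_mul (pow_dvd_pow _ hi) (pow_dvd_pow _ hj))
          (Ideal.subset_span h)
      by_cases ha : 3 ≤ a
      · exact hmul 3 0 ha (Nat.zero_le b) (by simp)
      · interval_cases a
        · exact hmul 0 5 le_rfl (by omega) (by simp)
        · exact hmul 1 3 le_rfl (by omega) (by simp)
        · exact hmul 2 2 le_rfl (by omega) (by simp)
    · rw [Ideal.span_le]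
      rintro p (rfl | rfl | rfl | rfl)
      · simpa using (hmem 3 0).2 h3.le
      · exact (hmem 2 2).2 h2.le
      · simpa using (hmem 1 3).2 h1.le
      · simpa using (hmem 0 5).2 h0.le
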